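/- arXiv:2412.03290 — 4 statements merged into one kernel-verified Lean document; each statement's English description precedes it below -/
import Mathlib

section
/- For |z| < 1/2 and parameters a, b, c with c not a nonpositive integer, the Pfaff transformation holds as an identity of convergent series: Σ_{k≥0} (a)_k (b)_k / (k! (c)_k) z^k = (1−z)^{−b} Σ_{k≥0} (c−a)_k (b)_k / (k! (c)_k) (z/(z−1))^k. -/
noncomputable def pochC (p : ℂ) (k : ℕ) : ℂ := (ascPochhammer ℂ k).eval p

lemma Ring.choose_add_natCast_sub_one_eq_div {K : Type*} [Field K] [CharZero K] [BinomialRing K]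
    (a : K) (n : ℕ) :
    Ring.choose (a + n - 1) n = (ascPochhammer K n).eval a / n.factorial := by
  rw [eq_div_iff (by exact_mod_cast n.factorial_ne_zero), ← Polynomial.ascPochhammer_smeval_eq_eval,
    ← Ring.factorial_nsmul_multichoose_eq_ascPochhammer, nsmul_eq_mul, mul_comm, Ring.choose,
    show a + n - 1 - n + 1 = a by ring]

lemma hasSum_pochC_div_factorial_mul_pow (a : ℂ) {z : ℂ} (hz : ‖z‖ < 1) :
    HasSum (fun n : ℕ ↦ pochC a n / n.factorial * z ^ n) ((1 - z) ^ (-a)) := by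
  have h := (Complex.one_div_one_sub_cpow_hasFPowerSeriesOnBall_zero a).hasSum (y := z)
    (by simpa [Metric.mem_eball, edist_zero_right, enorm_eq_nnnorm, ← NNReal.coe_lt_coe] using hz)
  simpa [Ring.choose_add_natCast_sub_one_eq_div, pochC, Complex.cpow_neg, mul_comm] using h

lemma hasSum_ascPochhammer_div_factorial_mul_pow (a : ℝ) {r : ℝ} (hr : |r| < 1) :
    HasSum (fun n : ℕ ↦ (ascPochhammer ℝ n).eval a / n.factorial * r ^ n) ((1 - r) ^ (-a)) := by
  have h := (Real.one_div_one_sub_rpow_hasFPowerSeriesOnBall_zero a).hasSum (y := r)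
    (by simpa [Metric.mem_eball, edist_zero_right, enorm_eq_nnnorm, ← NNReal.coe_lt_coe] using hr)
  simpa [Ring.choose_add_natCast_sub_one_eq_div, Real.rpow_neg (show 0 ≤ 1 - r by grind),
    mul_comm] using h

lemma pochC_zero (p : ℂ) : pochC p 0 = 1 := by simp [pochC]

lemma pochC_succ (p : ℂ) (n : ℕ) : pochC p (n + 1) = pochC p n * (p + n) :=
  ascPochhammer_succ_eval n p

lemma pochC_succ_left (p : ℂ) (n : ℕ) : pochC p (n + 1) = p * pochC (p + 1) n := by
  simp [pochC, ascPochhammer_succ_left, Polynomial.eval_comp]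

lemma pochC_add (p : ℂ) (m n : ℕ) : pochC p (m + n) = pochC p m * pochC (p + m) n := by
  simp [pochC, ← ascPochhammer_mul, Polynomial.eval_comp]

lemma pochC_ne_zero {c : ℂ} (hc : ∀ n : ℕ, c ≠ -(n : ℂ)) (n : ℕ) : pochC c n ≠ 0 := by
  induction n with
  | zero => simp [pochC_zero]
  | succ n ih => exact pochC_succ c n ▸ mul_ne_zero ih fun h ↦ hc n (eq_neg_of_add_eq_zero_left h)

lemma norm_pochC_le {p : ℂ} {q : ℝ} (h : ‖p‖ ≤ q) (n : ℕ) :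
    ‖pochC p n‖ ≤ (ascPochhammer ℝ n).eval q := by
  induction n with
  | zero => simp [pochC_zero]
  | succ n ih =>
    rw [pochC_succ, norm_mul, ascPochhammer_succ_eval]
    have := norm_add_le p n
    have := norm_nonneg (p + n)
    have := (norm_nonneg _).trans ih
    rw [Complex.norm_natCast] at *
    gcongr
    linarith

/-- The Chu–Vandermonde identity. -/
lemma sum_choose_mul_neg_one_pow_mul_pochC_div (n : ℕ) (x c : ℂ) (hc : ∀ n : ℕ, c ≠ -(n : ℂ)) :
    ∑ k ∈ Finset.range (n + 1), (n.choose k : ℂ) * ((-1) ^ k * (pochC x k / pochC c k)) =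
      pochC (c - x) n / pochC c n := by
  induction n generalizing x c with
  | zero => simp [pochC_zero]
  | succ n ih =>
    have hc' : ∀ n : ℕ, c + 1 ≠ -(n : ℂ) := fun m h ↦
      hc (m + 1) (by push_cast; linear_combination h)
    have hc0 : c ≠ 0 := by simpa using hc 0
    have hcn : c + n ≠ 0 := fun h ↦ hc n (eq_neg_of_add_eq_zero_left h)
    have h1 : ∑ k ∈ Finset.range (n + 1), (n.choose k : ℂ) *
        ((-1) ^ (k + 1) * (pochC x (k + 1) / pochC c (k + 1))) =
        -(x / c) * (pochC (c - x) n / pochC (c + 1) n) := by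
      rw [show c - x = c + 1 - (x + 1) by ring, ← ih (x + 1) (c + 1) hc', Finset.mul_sum]
      refine Finset.sum_congr rfl fun k _ ↦ ?_
      have := pochC_ne_zero hc' k
      rw [pochC_succ_left, pochC_succ_left]
      field
    rw [Finset.sum_choose_succ_mul (fun k _ ↦ (-1) ^ k * (pochC x k / pochC c k)), ih x c hc, h1]
    have h2 : pochC c n * (c + n) = c * pochC (c + 1) n := by
      rw [← pochC_succ, pochC_succ_left]
    have := pochC_ne_zero hc n
    have := pochC_ne_zero hc' n
    have h3 : pochC (c + 1) n = pochC c n * (c + n) / c := by rw [h2]; field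
    rw [pochC_succ, pochC_succ, h3]
    field

lemma summable_hypergeometric (a b c : ℂ) (hc : ∀ n : ℕ, c ≠ -(n : ℂ)) {w : ℂ} (hw : ‖w‖ < 1) :
    Summable fun k : ℕ ↦ pochC a k * pochC b k / ((k.factorial : ℂ) * pochC c k) * w ^ k := by
  obtain ⟨r, hwr, hr⟩ := exists_between hw
  refine summable_of_ratio_norm_eventually_le hr ?_
  have h : Filter.Tendsto (fun k : ℕ ↦ (a + k) / (1 + k) * ((b + k) / (c + k)) * w)
      Filter.atTop (nhds (1 * 1 * w)) := by
    refine Filter.Tendsto.mul_const w (Filter.Tendsto.mul ?_ ?_)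
    · simpa using tendsto_add_mul_div_add_mul_atTop_nhds a 1 (1 : ℂ) one_ne_zero
    · simpa using tendsto_add_mul_div_add_mul_atTop_nhds b c (1 : ℂ) one_ne_zero
  rw [one_mul, one_mul] at h
  filter_upwards [h.norm.eventually_le_const hwr] with k hk
  have hck := pochC_ne_zero hc k
  have hcn : c + k ≠ 0 := fun h ↦ hc k (eq_neg_of_add_eq_zero_left h)
  have hk1 : (1 + k : ℂ) ≠ 0 := by rw [add_comm]; exact Nat.cast_add_one_ne_zero k
  have hkf : (k.factorial : ℂ) ≠ 0 := by exact_mod_cast k.factorial_ne_zero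
  refine le_trans (le_of_eq ?_) (mul_le_mul_of_nonneg_right hk (norm_nonneg _))
  rw [← norm_mul, pochC_succ, pochC_succ, pochC_succ, Nat.factorial_succ]
  push_cast
  rw [add_comm (k : ℂ) 1]
  congr 1
  field

/-- Pfaff transformation as an identity of convergent series, for `|z| < 1/2`. -/
theorem pfaff_series (a b c z : ℂ)
    (hc : ∀ n : ℕ, c ≠ -(n : ℂ))
    (hz : ‖z‖ < 1/2) :
    (∑' k : ℕ, pochC a k * pochC b k / ((k.factorial : ℂ) * pochC c k) * z ^ k)
      = (1 - z) ^ (-b) *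
        ∑' k : ℕ, pochC (c - a) k * pochC b k / ((k.factorial : ℂ) * pochC c k) *
          (z / (z - 1)) ^ k := by
  have hz1 : ‖z‖ < 1 := by linarith
  have hne : 1 - z ≠ 0 := fun h ↦ by
    rw [← sub_eq_zero.mp h, norm_one] at hz1
    exact lt_irrefl _ hz1
  set A : ℕ → ℂ := fun k ↦ pochC (c - a) k * pochC b k / ((k.factorial : ℂ) * pochC c k) with hA
  let F : ℕ × ℕ → ℂ := fun p ↦
    A p.1 * (-z) ^ p.1 * (pochC (b + p.1) p.2 / p.2.factorial * z ^ p.2)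
  have hF : Summable F := by
    let G : ℕ × ℕ → ℝ := fun p ↦ ‖A p.1‖ * ‖z‖ ^ p.1 *
      ((ascPochhammer ℝ p.2).eval (‖b‖ + p.1) / p.2.factorial * ‖z‖ ^ p.2)
    have hb (k : ℕ) : ‖b + k‖ ≤ ‖b‖ + k := by simpa using norm_add_le b k
    have hFG (p : ℕ × ℕ) : ‖F p‖ ≤ G p := by
      simp only [F, G, norm_mul, norm_pow, norm_neg, norm_div, Complex.norm_natCast]
      gcongr
      exact norm_pochC_le (hb _) _
    have hin (k : ℕ) := (hasSum_ascPochhammer_div_factorial_mul_pow (‖b‖ + k)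
      (r := ‖z‖) (by simpa using hz1)).mul_left (‖A k‖ * ‖z‖ ^ k)
    refine Summable.of_norm_bounded (g := G) ?_ hFG
    refine (summable_prod_of_nonneg fun p ↦ (norm_nonneg _).trans (hFG p)).2
      ⟨fun k ↦ (hin k).summable, ?_⟩
    have hpos : 0 < 1 - ‖z‖ := by linarith
    have hw : ‖((‖z‖ / (1 - ‖z‖) : ℝ) : ℂ)‖ < 1 := by
      rw [Complex.norm_real, Real.norm_of_nonneg (by positivity), div_lt_one hpos]
      linarith
    refine (((summable_hypergeometric (c - a) b c hc hw).norm).mul_right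
      ((1 - ‖z‖) ^ (-‖b‖))).congr fun k ↦ ?_
    rw [(hin k).tsum_eq, norm_mul, norm_pow, Complex.norm_real,
      Real.norm_of_nonneg (by positivity), neg_add, Real.rpow_add hpos, Real.rpow_neg hpos.le k,
      Real.rpow_natCast, div_pow]
    ring
  have hrow (k : ℕ) : ∑' m, F (k, m) = (1 - z) ^ (-b) * (A k * (z / (z - 1)) ^ k) := by
    simp only [F]
    rw [((hasSum_pochC_div_factorial_mul_pow (b + k) hz1).mul_left _).tsum_eq, neg_add,
      Complex.cpow_add _ _ hne, Complex.cpow_neg _ (k : ℂ), Complex.cpow_natCast,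
      show z / (z - 1) = -z / (1 - z) by rw [← neg_sub 1 z, div_neg, neg_div], div_pow]
    ring
  have hdiag (n : ℕ) : ∑ p ∈ Finset.HasAntidiagonal.antidiagonal n, F p =
      pochC a n * pochC b n / ((n.factorial : ℂ) * pochC c n) * z ^ n := by
    have h := sum_choose_mul_neg_one_pow_mul_pochC_div n (c - a) c hc
    rw [sub_sub_cancel] at h
    rw [Finset.Nat.sum_antidiagonal_eq_sum_range_succ_mk]
    calc _ = ∑ k ∈ Finset.range (n + 1), pochC b n / n.factorial * z ^ n *
          ((n.choose k : ℂ) * ((-1) ^ k * (pochC (c - a) k / pochC c k))) := by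
          refine Finset.sum_congr rfl fun k hk ↦ ?_
          obtain ⟨m, rfl⟩ := Nat.exists_eq_add_of_le (Finset.mem_range_succ_iff.mp hk)
          have hf (j : ℕ) : (j.factorial : ℂ) ≠ 0 := by exact_mod_cast j.factorial_ne_zero
          have := hf k
          have := hf m
          have := hf (k + m)
          have := pochC_ne_zero hc k
          simp only [F, hA, Nat.add_sub_cancel_left]
          rw [Nat.cast_add_choose, pochC_add b k m, neg_pow z k, pow_add]
          field
      _ = _ := by
          rw [← Finset.mul_sum, h]
          ring
  have hσ : Summable fun p : (n : ℕ) × Finset.HasAntidiagonal.antidiagonal n ↦ F p.2 :=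
    Finset.HasAntidiagonal.sigmaAntidiagonalEquivProd.summable_iff.mpr hF
  rw [← tsum_mul_left, ← tsum_congr hrow, ← tsum_congr hdiag, ← hF.tsum_prod,
    ← Finset.HasAntidiagonal.sigmaAntidiagonalEquivProd.tsum_eq F]
  refine Eq.trans (tsum_congr fun n ↦ ?_) hσ.tsum_sigma.symm
  rw [tsum_fintype, Finset.sum_coe_sort _ F]
end

section
/- For |z| < 1, the quadratic transformation of the Gauss hypergeometric function with c = 2a holds: ₂F₁(a, b; 2a | z) = (1 − z/2)^{−b} · ₂F₁(b/2, b/2 + 1/2; a + 1/2 | z²/(2−z)²). -/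
noncomputable def hyp2F1 (a b c z : ℂ) : ℂ :=
  ∑' k : ℕ, pochC a k * pochC b k / (pochC c k * (k.factorial : ℂ)) * z ^ k

lemma pochC_ne_zero_s3 {p : ℂ} (hp : ∀ n : ℕ, p ≠ -(n : ℂ)) (n : ℕ) : pochC p n ≠ 0 := by
  induction n with
  | zero => simp [pochC_zero]
  | succ n ih =>
    rw [pochC_succ]
    exact mul_ne_zero ih fun h => hp n (eq_neg_of_add_eq_zero_left h)

lemma pochC_two_mul (p : ℂ) (k : ℕ) :
    pochC p (2 * k) = 4 ^ k * pochC (p / 2) k * pochC (p / 2 + 1 / 2) k := by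
  induction k with
  | zero => simp [pochC_zero]
  | succ k ih =>
    rw [show 2 * (k + 1) = 2 * k + 1 + 1 by ring, pochC_succ, pochC_succ, pochC_succ, pochC_succ,
      ih]
    push_cast
    ring

lemma pochC_ofReal_eq_norm {x : ℝ} (hx : 0 ≤ x) (n : ℕ) :
    pochC (x : ℂ) n = (‖pochC (x : ℂ) n‖ : ℂ) := by
  induction n with
  | zero => simp [pochC_zero]
  | succ n ih =>
    rw [pochC_succ, norm_mul, Complex.ofReal_mul, ← ih, ← Complex.ofReal_natCast,
      ← Complex.ofReal_add, Complex.norm_real, Real.norm_of_nonneg (by positivity)]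

lemma norm_pochC_le_s3 {p : ℂ} {x : ℝ} (hx : ‖p‖ ≤ x) (n : ℕ) :
    ‖pochC p n‖ ≤ ‖pochC (x : ℂ) n‖ := by
  have hx0 : 0 ≤ x := (norm_nonneg p).trans hx
  induction n with
  | zero => simp [pochC_zero]
  | succ n ih =>
    rw [pochC_succ, pochC_succ, norm_mul, norm_mul]
    gcongr
    rw [← Complex.ofReal_natCast, ← Complex.ofReal_add, Complex.norm_real,
      Real.norm_of_nonneg (by positivity)]
    refine (norm_add_le _ _).trans ?_
    simpa using hx

lemma hasSum_pochC_binomial (b : ℂ) {w : ℂ} (hw : ‖w‖ < 1) :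
    HasSum (fun n : ℕ => pochC b n / (n.factorial : ℂ) * w ^ n) ((1 - w) ^ (-b)) := by
  have h := (Complex.one_div_one_sub_cpow_hasFPowerSeriesOnBall_zero b).hasSum (y := w)
    (by rwa [Metric.mem_eball, edist_zero_right, ← ofReal_norm, ENNReal.ofReal_lt_one])
  simp only [FormalMultilinearSeries.ofScalars_apply_eq, zero_add, smul_eq_mul,
    ← Ring.multichoose_eq] at h
  rw [Complex.cpow_neg, ← one_div]
  refine h.congr_fun fun n => ?_
  have h1 := Ring.factorial_nsmul_multichoose_eq_ascPochhammer b n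
  rw [Polynomial.ascPochhammer_smeval_eq_eval, nsmul_eq_mul] at h1
  rw [pochC, ← h1, mul_div_cancel_left₀ _ (by exact_mod_cast n.factorial_ne_zero)]

/-- The reciprocal of `(n - 2 * k)!`, which vanishes when `n < 2 * k`. -/
noncomputable def invFactorialSub (n k : ℕ) : ℂ :=
  if 2 * k ≤ n then ((n - 2 * k).factorial : ℂ)⁻¹ else 0

lemma hasSum_pochC_invFactorialSub (b : ℂ) {w : ℂ} (hw : ‖w‖ < 1) (k : ℕ) :
    HasSum (fun n : ℕ => pochC b n * invFactorialSub n k * w ^ n)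
      (pochC b (2 * k) * (w / (1 - w)) ^ (2 * k) * (1 - w) ^ (-b)) := by
  have hw1 : 1 - w ≠ 0 := fun h => by
    rw [← sub_eq_zero.mp h] at hw
    simp at hw
  have h := (hasSum_pochC_binomial (b + (2 * k : ℕ)) hw).mul_left (pochC b (2 * k) * w ^ (2 * k))
  rw [neg_add, Complex.cpow_add _ _ hw1, Complex.cpow_neg _ ((2 * k : ℕ) : ℂ),
    Complex.cpow_natCast] at h
  rw [← (add_right_injective (2 * k)).hasSum_iff]
  · rw [show pochC b (2 * k) * (w / (1 - w)) ^ (2 * k) * (1 - w) ^ (-b) =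
        pochC b (2 * k) * w ^ (2 * k) * ((1 - w) ^ (-b) * ((1 - w) ^ (2 * k))⁻¹) by
      rw [div_pow]
      ring]
    refine h.congr_fun fun j => ?_
    simp only [Function.comp_apply, invFactorialSub, le_add_iff_nonneg_right, zero_le, if_true,
      add_tsub_cancel_left, pochC_add, pow_add]
    ring
  · intro n hn
    rw [invFactorialSub, if_neg, mul_zero, zero_mul]
    exact fun hle => hn ⟨n - 2 * k, Nat.add_sub_cancel' hle⟩

lemma succ_mul_invFactorialSub (n k : ℕ) :
    ((n : ℂ) + 1 - 2 * k) * invFactorialSub (n + 1) k = invFactorialSub n k := by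
  unfold invFactorialSub
  rcases lt_trichotomy (2 * k) (n + 1) with h | h | h
  · obtain ⟨m, rfl⟩ := Nat.exists_eq_add_of_le (Nat.lt_succ_iff.mp h)
    rw [if_pos (by omega), if_pos (by omega), show 2 * k + m + 1 - 2 * k = m + 1 by omega,
      add_tsub_cancel_left, Nat.factorial_succ]
    have : (m : ℂ) + 1 ≠ 0 := by exact_mod_cast m.succ_ne_zero
    have : (m.factorial : ℂ) ≠ 0 := by exact_mod_cast m.factorial_ne_zero
    push_cast
    field_simp
    ring
  · rw [if_neg (show ¬ 2 * k ≤ n by omega)]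
    have : (n : ℂ) + 1 = 2 * k := by exact_mod_cast h.symm
    rw [this, sub_self, zero_mul]
  · rw [if_neg (by omega), if_neg (by omega), mul_zero]

lemma invFactorialSub_succ_succ (n k : ℕ) :
    invFactorialSub (n + 2) (k + 1) = invFactorialSub n k := by
  unfold invFactorialSub
  simp only [mul_add, mul_one, add_le_add_iff_right, Nat.add_sub_add_right]

/-- The factor `1 / (4 ^ k * k! * (c)_k)` of the `k`-th term of the transformed series. -/
noncomputable def evenCoeff (c : ℂ) (k : ℕ) : ℂ := (4 ^ k * (k.factorial : ℂ) * pochC c k)⁻¹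

lemma evenCoeff_succ {c : ℂ} (hc : ∀ n : ℕ, c ≠ -(n : ℂ)) (k : ℕ) :
    4 * ((k : ℂ) + 1) * (c + k) * evenCoeff c (k + 1) = evenCoeff c k := by
  have h1 : c + k ≠ 0 := fun h => hc k (eq_neg_of_add_eq_zero_left h)
  have h2 := pochC_ne_zero_s3 hc k
  have h3 : (k : ℂ) + 1 ≠ 0 := by exact_mod_cast k.succ_ne_zero
  have h4 : (k.factorial : ℂ) ≠ 0 := by exact_mod_cast k.factorial_ne_zero
  rw [evenCoeff, evenCoeff, pochC_succ, Nat.factorial_succ]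
  push_cast
  field_simp
  ring

lemma sum_evenCoeff_recurrence {a : ℂ} (ha : ∀ n : ℕ, a + 1 / 2 ≠ -(n : ℂ)) {n N : ℕ}
    (hN : n < N) :
    ((n : ℂ) + 1) * (2 * a + n) *
        ∑ k ∈ Finset.range N, evenCoeff (a + 1 / 2) k * invFactorialSub (n + 1) k =
      2 * (a + n) * ∑ k ∈ Finset.range N, evenCoeff (a + 1 / 2) k * invFactorialSub n k := by
  have key := Finset.sum_range_sub (fun k : ℕ => -4 * (k : ℂ) * (a - 1 / 2 + k) *
    (evenCoeff (a + 1 / 2) k * invFactorialSub (n + 1) k)) N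
  have hlast : (N : ℂ) * invFactorialSub (n + 1) N = 0 := by
    rcases Nat.eq_zero_or_pos N with rfl | h
    · simp
    · rw [invFactorialSub, if_neg (by omega), mul_zero]
  rw [← sub_eq_zero, Finset.mul_sum, Finset.mul_sum, ← Finset.sum_sub_distrib]
  refine (Finset.sum_congr rfl fun k _ => ?_).trans (key.trans ?_)
  · have e1 := evenCoeff_succ ha k
    have e2 := succ_mul_invFactorialSub n k
    have e3 : ((n : ℂ) - 2 * k) * invFactorialSub n k = invFactorialSub (n + 1) (k + 1) := by
      cases n with
      | zero =>
        rw [invFactorialSub, invFactorialSub, if_neg (show ¬ 2 * (k + 1) ≤ 0 + 1 by omega)]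
        cases k <;> simp
      | succ m =>
        rw [invFactorialSub_succ_succ, ← succ_mul_invFactorialSub m k]
        push_cast
        ring
    push_cast
    rw [← e3, ← e2, ← e1]
    ring
  · simp only [Nat.cast_zero, mul_zero, zero_mul, sub_zero]
    linear_combination (-4 * (a - 1 / 2 + N) * evenCoeff (a + 1 / 2) N) * hlast

lemma sum_evenCoeff {a : ℂ} (h2a : ∀ n : ℕ, 2 * a ≠ -(n : ℂ))
    (ha : ∀ n : ℕ, a + 1 / 2 ≠ -(n : ℂ)) {n N : ℕ} (hN : n < N) :
    ∑ k ∈ Finset.range N, evenCoeff (a + 1 / 2) k * invFactorialSub n k =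
      2 ^ n * pochC a n / (pochC (2 * a) n * (n.factorial : ℂ)) := by
  induction n with
  | zero =>
    rw [Finset.sum_eq_single_of_mem 0 (Finset.mem_range.mpr hN)]
    · simp [evenCoeff, invFactorialSub, pochC_zero]
    · intro k _ hk
      rw [invFactorialSub, if_neg (by omega), mul_zero]
  | succ n ih =>
    have h := sum_evenCoeff_recurrence ha (show n < N by omega)
    rw [ih (by omega)] at h
    have h1 : 2 * a + n ≠ 0 := fun h => h2a n (eq_neg_of_add_eq_zero_left h)
    have h2 := pochC_ne_zero_s3 h2a n
    have h3 : (n : ℂ) + 1 ≠ 0 := by exact_mod_cast n.succ_ne_zero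
    have h4 : (n.factorial : ℂ) ≠ 0 := by exact_mod_cast n.factorial_ne_zero
    refine mul_left_cancel₀ (mul_ne_zero h3 h1) (h.trans ?_)
    rw [pochC_succ, pochC_succ, Nat.factorial_succ]
    push_cast
    field_simp
    ring

lemma evenCoeff_mul_pochC_two_mul (b c x : ℂ) (k : ℕ) :
    evenCoeff c k * (pochC b (2 * k) * x ^ (2 * k)) =
      pochC (b / 2) k * pochC (b / 2 + 1 / 2) k / (pochC c k * (k.factorial : ℂ)) *
        (x ^ 2) ^ k := by
  rw [evenCoeff, pochC_two_mul, pow_mul, div_eq_mul_inv]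
  simp only [mul_inv]
  have : (4 : ℂ) ^ k ≠ 0 := pow_ne_zero k (by norm_num)
  field_simp

lemma summable_norm_hyp2F1 {a b c x : ℂ} (ha : ∀ n : ℕ, a ≠ -(n : ℂ))
    (hb : ∀ n : ℕ, b ≠ -(n : ℂ)) (hc : ∀ n : ℕ, c ≠ -(n : ℂ)) (hx : ‖x‖ < 1) :
    Summable fun k : ℕ => ‖pochC a k * pochC b k / (pochC c k * (k.factorial : ℂ)) * x ^ k‖ := by
  have hr : (ordinaryHypergeometricSeries ℂ a b c).radius = 1 :=
    ordinaryHypergeometricSeries_radius_eq_one ℂ a b c fun n =>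
      ⟨fun h => ha n (by rw [h, neg_neg]), fun h => hb n (by rw [h, neg_neg]),
        fun h => hc n (by rw [h, neg_neg])⟩
  have h := (ordinaryHypergeometricSeries ℂ a b c).summable_norm_apply (x := x)
    (by rwa [hr, Metric.mem_eball, edist_zero_right, ← ofReal_norm, ENNReal.ofReal_lt_one])
  refine h.congr fun k => ?_
  rw [ordinaryHypergeometricSeries_apply_eq, smul_eq_mul, div_eq_mul_inv, mul_inv]
  congr 2
  simp only [pochC]
  ring

lemma hasSum_norm_of_eq_norm {f : ℕ → ℂ} {s : ℂ} (hf : ∀ n, f n = (‖f n‖ : ℂ))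
    (h : HasSum f s) : HasSum (fun n => ‖f n‖) ‖s‖ := by
  have h1 := Complex.hasSum_re h
  simp_rw [fun n => (congrArg Complex.re (hf n)).trans (Complex.ofReal_re _)] at h1
  have h2 : HasSum f (s.re : ℂ) := by
    rw [funext hf]
    exact Complex.hasSum_ofReal.mpr h1
  rw [h.unique h2, Complex.norm_real, Real.norm_of_nonneg (h1.nonneg fun n => norm_nonneg _)]
  exact h1

lemma summable_evenCoeff_mul_pochC (b : ℂ) {c w : ℂ} (hc : ∀ n : ℕ, c ≠ -(n : ℂ))
    (hw : ‖w‖ < 1 / 2) :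
    Summable fun p : ℕ × ℕ =>
      evenCoeff c p.1 * (pochC b p.2 * invFactorialSub p.2 p.1 * w ^ p.2) := by
  set r : ℝ := ‖w‖ with hr
  have hr0 : 0 ≤ r := norm_nonneg w
  have hr1 : ‖(r : ℂ)‖ < 1 := by
    rw [Complex.norm_real, Real.norm_of_nonneg hr0]
    linarith
  set β : ℝ := ‖b‖ + 1 with hβ
  have hβ0 : 0 < β := by positivity
  have hinv (n k : ℕ) : invFactorialSub n k = (‖invFactorialSub n k‖ : ℂ) := by
    unfold invFactorialSub
    split_ifs <;> simp
  have hrow (k : ℕ) := (hasSum_norm_of_eq_norm (fun n => by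
    rw [norm_mul, norm_mul, Complex.ofReal_mul, Complex.ofReal_mul, ← hinv,
      ← pochC_ofReal_eq_norm hβ0.le, norm_pow, Complex.norm_real, Real.norm_of_nonneg hr0,
      Complex.ofReal_pow])
    (hasSum_pochC_invFactorialSub (β : ℂ) hr1 k)).mul_left ‖evenCoeff c k‖
  have hpos {x : ℝ} (hx : 0 < x) (n : ℕ) : (x : ℂ) ≠ -(n : ℂ) := by
    intro h
    have h' : x = -(n : ℝ) := by exact_mod_cast h
    have : (0 : ℝ) ≤ n := n.cast_nonneg
    linarith
  have hq : ‖((r : ℂ) / (1 - r)) ^ 2‖ < 1 := by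
    rw [← Complex.ofReal_one, ← Complex.ofReal_sub, ← Complex.ofReal_div, norm_pow,
      Complex.norm_real, Real.norm_of_nonneg (div_nonneg hr0 (by linarith))]
    refine pow_lt_one₀ (div_nonneg hr0 (by linarith)) ?_ two_ne_zero
    rw [div_lt_one (by linarith)]
    linarith
  have hmaj : Summable fun p : ℕ × ℕ => ‖evenCoeff c p.1‖ *
      ‖pochC (β : ℂ) p.2 * invFactorialSub p.2 p.1 * (r : ℂ) ^ p.2‖ := by
    rw [summable_prod_of_nonneg fun p => by positivity]
    refine ⟨fun k => (hrow k).summable, ?_⟩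
    have h := (summable_norm_hyp2F1 (a := (β : ℂ) / 2) (b := (β : ℂ) / 2 + 1 / 2) (c := c)
      (by exact_mod_cast hpos (half_pos hβ0)) (fun n => by
        have := hpos (show 0 < β / 2 + 1 / 2 by positivity) n
        push_cast at this
        exact this) hc hq).mul_right ‖(1 - (r : ℂ)) ^ (-(β : ℂ))‖
    refine h.congr fun k => ?_
    rw [(hrow k).tsum_eq, ← evenCoeff_mul_pochC_two_mul, ← norm_mul, ← norm_mul, mul_assoc]
  refine Summable.of_norm_bounded hmaj fun p => ?_
  rw [norm_mul, norm_mul, norm_mul, norm_mul, norm_mul, norm_pow, norm_pow, Complex.norm_real,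
    Real.norm_of_nonneg hr0]
  gcongr
  exact norm_pochC_le_s3 (by linarith) _

/-- Quadratic transformation of the Gauss hypergeometric function with `c = 2a`. -/
theorem quadratic_transformation (a b z : ℂ)
    (h2a : ∀ n : ℕ, 2 * a ≠ -(n : ℂ))
    (ha : ∀ n : ℕ, a + 1/2 ≠ -(n : ℂ))
    (hz : ‖z‖ < 1)
    (hz' : ‖z / (2 - z)‖ < 1) :
    hyp2F1 a b (2 * a) z =
      (1 - z / 2) ^ (-b) *
        hyp2F1 (b / 2) (b / 2 + 1/2) (a + 1/2) (z ^ 2 / (2 - z) ^ 2) := by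
  have hw : ‖z / 2‖ < 1 / 2 := by
    rw [norm_div, Complex.norm_ofNat]
    linarith
  have hsum := summable_evenCoeff_mul_pochC b ha hw
  have hcomm := Summable.tsum_comm (f := fun k n : ℕ => evenCoeff (a + 1 / 2) k *
    (pochC b n * invFactorialSub n k * (z / 2) ^ n)) hsum
  have hquot : z / 2 / (1 - z / 2) = z / (2 - z) := by
    rw [show 1 - z / 2 = (2 - z) / 2 by ring, div_div_div_cancel_right₀ two_ne_zero]
  rw [hyp2F1, hyp2F1, ← tsum_mul_left]
  trans ∑' n : ℕ, ∑' k : ℕ, evenCoeff (a + 1 / 2) k *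
      (pochC b n * invFactorialSub n k * (z / 2) ^ n)
  · refine tsum_congr fun n => ?_
    rw [tsum_eq_sum (s := Finset.range (n + 1))]
    · trans (∑ k ∈ Finset.range (n + 1), evenCoeff (a + 1 / 2) k * invFactorialSub n k) *
          (pochC b n * (z / 2) ^ n)
      · rw [sum_evenCoeff h2a ha n.lt_succ_self, div_pow]
        have : (2 : ℂ) ^ n ≠ 0 := pow_ne_zero n two_ne_zero
        field_simp
      · rw [Finset.sum_mul]
        exact Finset.sum_congr rfl fun k _ => by ring
    · intro k hk
      rw [Finset.mem_range, not_lt] at hk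
      rw [invFactorialSub, if_neg (by omega), mul_zero, zero_mul, mul_zero]
  · rw [hcomm]
    refine tsum_congr fun k => ?_
    rw [tsum_mul_left, (hasSum_pochC_invFactorialSub b (by linarith) k).tsum_eq, ← mul_assoc,
      evenCoeff_mul_pochC_two_mul, hquot, div_pow, mul_comm]
end

section
/- For h > 1/2 (real) and points x = (ρ, z), x' = (ρ', z') in ℝ², the function G(x,x'|h) = (ξ/2)^h · ₂F₁(h/2, h/2 + 1/2; h + 1/2 | ξ²), with ξ = ξ(x,x') the AdS invariant distance, satisfies the homogeneous Klein–Gordon equation in the first argument away from coincident points: (e^{−2ρ} ∂²_z + ∂²_ρ + ∂_ρ − h(h−1)) G(x,x'|h) = 0 for x ≠ x'. -/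
noncomputable def pochR (p : ℝ) (k : ℕ) : ℝ := (ascPochhammer ℝ k).eval p

noncomputable def hyp2F1R (a b c z : ℝ) : ℝ :=
  ∑' k : ℕ, pochR a k * pochR b k / (pochR c k * (k.factorial : ℝ)) * z ^ k

/-- The AdS invariant distance. -/
noncomputable def xiDist (ρ z ρ' z' : ℝ) : ℝ :=
  2 * Real.exp (-ρ - ρ') / (Real.exp (-2 * ρ) + Real.exp (-2 * ρ') + (z - z') ^ 2)

/-- The bulk-to-bulk propagator `G(x,x'|h)` as a function of `(z, ρ)` with
`(ρ', z')` fixed. -/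
noncomputable def Gbb (h ρ' z' : ℝ) (z ρ : ℝ) : ℝ :=
  (xiDist ρ z ρ' z' / 2) ^ h *
    hyp2F1R (h / 2) (h / 2 + 1/2) (h + 1/2) ((xiDist ρ z ρ' z') ^ 2)

section PowerSeries

open Filter Topology

variable {a : ℕ → ℝ}

theorem summable_deriv_powerSeries (ha : ∀ x : ℝ, |x| < 1 → Summable fun n => a n * x ^ n)
    {x : ℝ} (hx : |x| < 1) : Summable fun n : ℕ => ((n : ℝ) + 1) * a (n + 1) * x ^ n := by
  obtain ⟨r, hxr, hr1⟩ := exists_between hx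
  have hr0 : 0 < r := (abs_nonneg x).trans_lt hxr
  have hr : Summable fun n => a n * r ^ n := ha r (by rwa [abs_of_pos hr0])
  obtain ⟨C, hC⟩ := hr.tendsto_atTop_zero.norm.bddAbove_range
  have hC' : ∀ n, |a n| * r ^ n ≤ C := fun n => by
    have := hC ⟨n, rfl⟩
    simpa [abs_mul, abs_of_pos hr0] using this
  have hq : ‖|x| / r‖ < 1 := by
    rw [Real.norm_of_nonneg (by positivity)]
    exact (div_lt_one hr0).2 hxr
  have hs : Summable fun n : ℕ => C / r * (((n : ℝ) ^ 1 * (|x| / r) ^ n) + (|x| / r) ^ n) :=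
    ((summable_pow_mul_geometric_of_norm_lt_one 1 hq).add
      (summable_geometric_of_norm_lt_one hq)).mul_left _
  refine Summable.of_norm_bounded hs fun n => ?_
  have h1 : |a (n + 1)| ≤ C / r / r ^ n := by
    rw [div_div, le_div_iff₀ (by positivity), ← pow_succ']
    exact hC' (n + 1)
  have h2 : ‖((n : ℝ) + 1) * a (n + 1) * x ^ n‖ = (n + 1) * |a (n + 1)| * |x| ^ n := by
    rw [norm_mul, norm_mul, norm_pow, Real.norm_of_nonneg (by positivity)]
    rfl
  rw [h2]
  calc ((n : ℝ) + 1) * |a (n + 1)| * |x| ^ n ≤ (n + 1) * (C / r / r ^ n) * |x| ^ n := by gcongr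
    _ = _ := by rw [div_pow]; ring

theorem hasDerivAt_tsum_powerSeries (ha : ∀ x : ℝ, |x| < 1 → Summable fun n => a n * x ^ n)
    {x : ℝ} (hx : |x| < 1) :
    HasDerivAt (fun y => ∑' n, a n * y ^ n) (∑' n : ℕ, ((n : ℝ) + 1) * a (n + 1) * x ^ n) x := by
  obtain ⟨r, hxr, hr1⟩ := exists_between hx
  have hr0 : 0 < r := (abs_nonneg x).trans_lt hxr
  have hsum : ∀ y : ℝ, |y| < 1 → Summable fun n : ℕ => a n * ((n : ℝ) * y ^ (n - 1)) := by
    intro y hy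
    rw [← summable_nat_add_iff 1]
    refine (summable_deriv_powerSeries ha hy).congr fun n => ?_
    simp only [Nat.add_sub_cancel, Nat.cast_add, Nat.cast_one]
    ring
  have key := hasDerivAt_tsum_of_isPreconnected (g := fun n y => a n * y ^ n)
    (g' := fun n y => a n * ((n : ℝ) * y ^ (n - 1))) (t := Set.Ioo (-r) r) (y₀ := x) (y := x)
    (hsum r (by rwa [abs_of_pos hr0])).norm isOpen_Ioo isPreconnected_Ioo
    (fun n y _ => (hasDerivAt_pow n y).const_mul (a n))
    (fun n y hy => by
      rw [norm_mul, norm_mul, norm_mul, norm_mul, norm_pow, norm_pow]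
      have : ‖y‖ ≤ ‖r‖ := by
        rw [Real.norm_of_nonneg hr0.le]
        exact (abs_lt.2 hy).le
      gcongr)
    (abs_lt.1 hxr) (ha x hx) (abs_lt.1 hxr)
  refine key.congr_deriv ?_
  rw [(hsum x hx).tsum_eq_zero_add]
  simp only [Nat.cast_zero, zero_mul, mul_zero, zero_add]
  refine tsum_congr fun n => ?_
  simp only [Nat.add_sub_cancel, Nat.cast_add, Nat.cast_one]
  ring

theorem HasSum.mul_powerSeries_shift {b : ℕ → ℝ} {x s : ℝ} (hb : b 0 = 0)
    (hs : HasSum (fun n => b (n + 1) * x ^ n) s) : HasSum (fun n => b n * x ^ n) (x * s) := by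
  rw [← hasSum_nat_add_iff' 1]
  simp only [Finset.sum_range_one, hb, zero_mul, sub_zero]
  exact (hs.mul_left x).congr_fun fun n => by ring

end PowerSeries

section Hypergeometric

open Filter Topology

/-- Coefficients of the real hypergeometric series. -/
noncomputable def hypCoeff (a b c : ℝ) (k : ℕ) : ℝ :=
  pochR a k * pochR b k / (pochR c k * (k.factorial : ℝ))

variable {a b c : ℝ}

theorem pochR_pos (ha : 0 < a) (k : ℕ) : 0 < pochR a k := ascPochhammer_pos k a ha

theorem pochR_succ (a : ℝ) (k : ℕ) : pochR a (k + 1) = pochR a k * (a + k) :=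
  ascPochhammer_succ_eval k a

theorem hypCoeff_pos (ha : 0 < a) (hb : 0 < b) (hc : 0 < c) (k : ℕ) : 0 < hypCoeff a b c k := by
  have := pochR_pos ha k
  have := pochR_pos hb k
  have := pochR_pos hc k
  unfold hypCoeff
  positivity

theorem hypCoeff_succ (hc : 0 < c) (k : ℕ) :
    (k + 1) * (c + k) * hypCoeff a b c (k + 1) = (a + k) * (b + k) * hypCoeff a b c k := by
  have h1 := (pochR_pos hc k).ne'
  have h2 : c + k ≠ 0 := by positivity
  have h3 : (k.factorial : ℝ) ≠ 0 := by positivity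
  have h4 : (k : ℝ) + 1 ≠ 0 := by positivity
  simp only [hypCoeff, pochR_succ, Nat.factorial_succ, Nat.cast_mul, Nat.cast_add, Nat.cast_one]
  field_simp

theorem summable_hypCoeff (ha : 0 < a) (hb : 0 < b) (hc : 0 < c) {x : ℝ} (hx : |x| < 1) :
    Summable fun n => hypCoeff a b c n * x ^ n := by
  rcases eq_or_ne x 0 with rfl | hx0
  · refine summable_of_ne_finset_zero (s := {0}) fun n hn => ?_
    simp [show n ≠ 0 by simpa using hn]
  refine summable_of_ratio_test_tendsto_lt_one hx
    (.of_forall fun n => mul_ne_zero (hypCoeff_pos ha hb hc n).ne' (pow_ne_zero _ hx0)) ?_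
  have h1 : Tendsto (fun n : ℕ => (a + n) / (1 + n)) atTop (𝓝 1) := by
    simpa using tendsto_add_mul_div_add_mul_atTop_nhds a 1 (1 : ℝ) one_ne_zero
  have h2 : Tendsto (fun n : ℕ => (b + n) / (c + n)) atTop (𝓝 1) := by
    simpa using tendsto_add_mul_div_add_mul_atTop_nhds b c (1 : ℝ) one_ne_zero
  have h3 := (h1.mul h2).mul_const |x|
  rw [one_mul, one_mul] at h3
  refine h3.congr fun n => ?_
  have e := hypCoeff_succ (a := a) (b := b) hc n
  have p := hypCoeff_pos ha hb hc n
  have q := hypCoeff_pos ha hb hc (n + 1)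
  have hxp : 0 < |x| := abs_pos.2 hx0
  simp only [norm_mul, norm_pow, Real.norm_eq_abs, abs_of_pos p, abs_of_pos q]
  have h4 : (c + n : ℝ) ≠ 0 := by positivity
  have h5 : (1 + n : ℝ) ≠ 0 := by positivity
  field_simp
  linear_combination (-|x| * |x| ^ n) * e

/-- The hypergeometric function is twice differentiable on the unit interval and satisfies the
hypergeometric equation there. -/
theorem exists_hyp2F1R_ode (ha : 0 < a) (hb : 0 < b) (hc : 0 < c) :
    ∃ F' F'' : ℝ → ℝ, ∀ w, |w| < 1 →
      HasDerivAt (hyp2F1R a b c) (F' w) w ∧ HasDerivAt F' (F'' w) w ∧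
      w * (1 - w) * F'' w + (c - (a + b + 1) * w) * F' w - a * b * hyp2F1R a b c w = 0 := by
  set u := hypCoeff a b c
  have s0 : ∀ x : ℝ, |x| < 1 → Summable fun n => u n * x ^ n :=
    fun x hx => summable_hypCoeff ha hb hc hx
  have s1 : ∀ x : ℝ, |x| < 1 → Summable fun n : ℕ => ((n : ℝ) + 1) * u (n + 1) * x ^ n :=
    fun x hx => summable_deriv_powerSeries s0 hx
  have s2 : ∀ x : ℝ, |x| < 1 →
      Summable fun n : ℕ => ((n : ℝ) + 1) * (((n + 1 : ℕ) + 1) * u (n + 1 + 1)) * x ^ n :=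
    fun x hx => summable_deriv_powerSeries (a := fun n : ℕ => ((n : ℝ) + 1) * u (n + 1)) s1 hx
  refine ⟨fun x => ∑' n : ℕ, ((n : ℝ) + 1) * u (n + 1) * x ^ n,
    fun x => ∑' n : ℕ, ((n : ℝ) + 1) * (((n + 1 : ℕ) + 1) * u (n + 1 + 1)) * x ^ n,
    fun w hw => ⟨hasDerivAt_tsum_powerSeries s0 hw, hasDerivAt_tsum_powerSeries
      (a := fun n : ℕ => ((n : ℝ) + 1) * u (n + 1)) s1 hw, ?_⟩⟩
  have H0 := (s0 w hw).hasSum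
  have H1 := (s1 w hw).hasSum
  have H2 := (s2 w hw).hasSum
  push_cast at H2 ⊢
  have H1' := HasSum.mul_powerSeries_shift (b := fun n : ℕ => (n : ℝ) * u n) (by simp)
    (by simpa using H1)
  have H2' := HasSum.mul_powerSeries_shift (b := fun n : ℕ => (n : ℝ) * ((n + 1) * u (n + 1)))
    (by simp) (by simpa using H2)
  have H2'' := HasSum.mul_powerSeries_shift (b := fun n : ℕ => (n : ℝ) * ((n - 1) * u n))
    (by simp) (H2'.congr_fun fun n => by push_cast; ring)
  have T := ((H2'.add (H1.mul_left c)).sub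
    ((H2''.add (H1'.mul_left (a + b + 1))).add (H0.mul_left (a * b)))).unique
      (hasSum_zero.congr_fun fun n => by
        linear_combination w ^ n * hypCoeff_succ (a := a) (b := b) hc n)
  have hF : hyp2F1R a b c w = ∑' n, u n * w ^ n := rfl
  rw [hF]
  linear_combination T

end Hypergeometric

/-- The propagator as a function of the invariant distance. -/
noncomputable def radialPropagator (h x : ℝ) : ℝ :=
  (x / 2) ^ h * hyp2F1R (h / 2) (h / 2 + 1/2) (h + 1/2) (x ^ 2)

theorem hasDerivAt_half_rpow_mul (h : ℝ) {A : ℝ → ℝ} {A' x : ℝ} (hx : 0 < x)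
    (hA : HasDerivAt A A' x) :
    HasDerivAt (fun y => (y / 2) ^ h * A y) ((x / 2) ^ h * (h / x * A x + A')) x := by
  have h1 : HasDerivAt (fun y : ℝ => (y / 2) ^ h) ((1 / 2) * h * (x / 2) ^ (h - 1)) x :=
    ((hasDerivAt_id x).div_const 2).rpow_const (Or.inl (by simpa using hx.ne'))
  refine (h1.mul hA).congr_deriv ?_
  rw [Real.rpow_sub_one (by positivity)]
  field_simp

theorem exists_radialPropagator_ode {h : ℝ} (hh : 0 < h) :
    ∃ g' g'' : ℝ → ℝ, ∀ x ∈ Set.Ioo (0 : ℝ) 1,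
      HasDerivAt (radialPropagator h) (g' x) x ∧ HasDerivAt g' (g'' x) x ∧
      x ^ 2 * (1 - x ^ 2) * g'' x - 2 * x ^ 3 * g' x
        - h * (h - 1) * radialPropagator h x = 0 := by
  obtain ⟨F', F'', hF⟩ := exists_hyp2F1R_ode (a := h / 2) (b := h / 2 + 1/2) (c := h + 1/2)
    (by positivity) (by positivity) (by positivity)
  set F := hyp2F1R (h / 2) (h / 2 + 1/2) (h + 1/2)
  refine ⟨fun x => (x / 2) ^ h * (h / x * F (x ^ 2) + F' (x ^ 2) * (2 * x)),
    fun x => (x / 2) ^ h * (h / x * (h / x * F (x ^ 2) + F' (x ^ 2) * (2 * x)) +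
      (-h / x ^ 2 * F (x ^ 2) + h / x * (F' (x ^ 2) * (2 * x)) +
        (F'' (x ^ 2) * (2 * x) * (2 * x) + F' (x ^ 2) * 2))), fun x hx => ?_⟩
  have hx0 : 0 < x := hx.1
  have hw : |x ^ 2| < 1 := by
    rw [abs_of_pos (by positivity)]
    exact pow_lt_one₀ hx0.le hx.2 two_ne_zero
  obtain ⟨d1, d2, ode⟩ := hF _ hw
  have sq : HasDerivAt (fun y : ℝ => y ^ 2) (2 * x) x := by simpa using hasDerivAt_pow 2 x
  have e1 : HasDerivAt (fun y => F (y ^ 2)) (F' (x ^ 2) * (2 * x)) x :=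
    HasDerivAt.comp (h := fun y => y ^ 2) x d1 sq
  have e2 : HasDerivAt (fun y => F' (y ^ 2)) (F'' (x ^ 2) * (2 * x)) x :=
    HasDerivAt.comp (h := fun y => y ^ 2) x d2 sq
  have inv : HasDerivAt (fun y : ℝ => h / y) (-h / x ^ 2) x := by
    simpa using (hasDerivAt_const x h).fun_div (hasDerivAt_id x) hx0.ne'
  have lin : HasDerivAt (fun y : ℝ => 2 * y) 2 x := by simpa using (hasDerivAt_id x).const_mul 2
  refine ⟨hasDerivAt_half_rpow_mul h hx0 e1,
    hasDerivAt_half_rpow_mul h hx0 ((inv.mul e1).add (e2.mul lin)), ?_⟩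
  have hR : radialPropagator h x = (x / 2) ^ h * F (x ^ 2) := rfl
  rw [hR]
  field_simp
  linear_combination 4 * x ^ 2 * (x / 2) ^ h * ode

theorem deriv_comp_and_deriv_deriv_comp {g g' g'' φ φ' : ℝ → ℝ} {φ'' t : ℝ} {s : Set ℝ}
    (hs : IsOpen s) (hg : ∀ x ∈ s, HasDerivAt g (g' x) x ∧ HasDerivAt g' (g'' x) x)
    (hφ : ∀ y, HasDerivAt φ (φ' y) y) (hφ' : HasDerivAt φ' φ'' t) (ht : φ t ∈ s) :
    deriv (fun y => g (φ y)) t = g' (φ t) * φ' t ∧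
      deriv (deriv fun y => g (φ y)) t = g'' (φ t) * φ' t ^ 2 + g' (φ t) * φ'' := by
  have hd : ∀ y, φ y ∈ s → HasDerivAt (fun y => g (φ y)) (g' (φ y) * φ' y) y :=
    fun y hy => (hg _ hy).1.comp y (hφ y)
  refine ⟨(hd t ht).deriv, ?_⟩
  have hev : deriv (fun y => g (φ y)) =ᶠ[nhds t] fun y => g' (φ y) * φ' y := by
    filter_upwards [(hφ t).continuousAt.eventually_mem (hs.mem_nhds ht)] with y hy
    exact (hd y hy).deriv
  rw [hev.deriv_eq]
  refine (((hg _ ht).2.comp t (hφ t)).mul hφ').deriv.trans ?_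
  simp only [Function.comp_apply]
  ring

theorem xiDist_mem_Ioo {ρ z ρ' z' : ℝ} (hne : (ρ, z) ≠ (ρ', z')) :
    xiDist ρ z ρ' z' ∈ Set.Ioo (0 : ℝ) 1 := by
  have hD : 0 < Real.exp (-2 * ρ) + Real.exp (-2 * ρ') + (z - z') ^ 2 := by positivity
  refine ⟨div_pos (by positivity) hD, (div_lt_one hD).2 ?_⟩
  have h1 : Real.exp (-ρ - ρ') = Real.exp (-ρ) * Real.exp (-ρ') := by
    rw [← Real.exp_add]; ring_nf
  have h2 : ∀ t : ℝ, Real.exp (-2 * t) = Real.exp (-t) ^ 2 := fun t => by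
    rw [← Real.exp_nat_mul]; push_cast; ring_nf
  rw [h1, h2, h2]
  suffices 0 < (Real.exp (-ρ) - Real.exp (-ρ')) ^ 2 + (z - z') ^ 2 by linarith
  by_cases hρ : ρ = ρ'
  · have : z - z' ≠ 0 := sub_ne_zero.2 fun hz => hne (by rw [hρ, hz])
    positivity
  · have : Real.exp (-ρ) - Real.exp (-ρ') ≠ 0 :=
      sub_ne_zero.2 fun he => hρ (neg_injective (Real.exp_injective he))
    positivity

theorem hasDerivAt_xiDist_fst {N A : ℝ} (hA : 0 < A) (z' t : ℝ) :
    HasDerivAt (fun t => N / (A + (t - z') ^ 2)) (-2 * N * (t - z') / (A + (t - z') ^ 2) ^ 2) t ∧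
    HasDerivAt (fun t => -2 * N * (t - z') / (A + (t - z') ^ 2) ^ 2)
      (-2 * N / (A + (t - z') ^ 2) ^ 2 + 8 * N * (t - z') ^ 2 / (A + (t - z') ^ 2) ^ 3) t := by
  have hD : A + (t - z') ^ 2 ≠ 0 := by positivity
  have h0 : HasDerivAt (fun t : ℝ => t - z') 1 t := (hasDerivAt_id t).sub_const z'
  have h1 : HasDerivAt (fun t : ℝ => A + (t - z') ^ 2) (2 * (t - z')) t := by
    simpa using (h0.pow 2).const_add A
  constructor
  · refine ((hasDerivAt_const t N).fun_div h1 hD).congr_deriv ?_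
    ring
  · refine ((h0.const_mul (-2 * N)).fun_div (h1.pow 2) (pow_ne_zero 2 hD)).congr_deriv ?_
    simp only [Pi.pow_apply]
    field_simp
    ring

theorem hasDerivAt_xiDist_snd {K : ℝ} (hK : 0 < K) (ρ' t : ℝ) :
    HasDerivAt (fun t => 2 * Real.exp (-t - ρ') / (Real.exp (-2 * t) + K))
      (2 * Real.exp (-t - ρ') * (Real.exp (-2 * t) - K) / (Real.exp (-2 * t) + K) ^ 2) t ∧
    HasDerivAt
      (fun t => 2 * Real.exp (-t - ρ') * (Real.exp (-2 * t) - K) / (Real.exp (-2 * t) + K) ^ 2)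
      (2 * Real.exp (-t - ρ') * (K - 3 * Real.exp (-2 * t)) / (Real.exp (-2 * t) + K) ^ 2 +
        8 * Real.exp (-t - ρ') * Real.exp (-2 * t) * (Real.exp (-2 * t) - K) /
          (Real.exp (-2 * t) + K) ^ 3) t := by
  have hD : Real.exp (-2 * t) + K ≠ 0 := by positivity
  have hN : HasDerivAt (fun t => 2 * Real.exp (-t - ρ')) (-(2 * Real.exp (-t - ρ'))) t := by
    refine ((((hasDerivAt_id t).neg.sub_const ρ').exp).const_mul 2).congr_deriv ?_
    simp
  have hE : HasDerivAt (fun t => Real.exp (-2 * t)) (-2 * Real.exp (-2 * t)) t := by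
    refine (((hasDerivAt_id t).const_mul (-2)).exp).congr_deriv ?_
    simp; ring
  constructor
  · refine (hN.fun_div (hE.add_const K) hD).congr_deriv ?_
    field_simp
    ring
  · refine ((hN.fun_mul (hE.sub_const K)).fun_div ((hE.add_const K).fun_pow 2)
      (pow_ne_zero 2 hD)).congr_deriv ?_
    field_simp
    ring

/-- The bulk-to-bulk propagator satisfies the homogeneous Klein–Gordon equation
away from coincident points. -/
theorem Gbb_klein_gordon (h : ℝ) (hh : 1/2 < h) (ρ z ρ' z' : ℝ)
    (hne : (ρ, z) ≠ (ρ', z')) :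
    Real.exp (-2 * ρ) * deriv (deriv (fun t => Gbb h ρ' z' t ρ)) z
      + deriv (deriv (fun t => Gbb h ρ' z' z t)) ρ
      + deriv (fun t => Gbb h ρ' z' z t) ρ
      - h * (h - 1) * Gbb h ρ' z' z ρ = 0 := by
  obtain ⟨g', g'', hg⟩ := exists_radialPropagator_ode (h := h) (by linarith)
  have hξ := xiDist_mem_Ioo hne
  have hg' := fun x hx => (⟨(hg x hx).1, (hg x hx).2.1⟩ :
    HasDerivAt (radialPropagator h) (g' x) x ∧ HasDerivAt g' (g'' x) x)
  have hA : 0 < Real.exp (-2 * ρ) + Real.exp (-2 * ρ') := by positivity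
  have hK : 0 < Real.exp (-2 * ρ') + (z - z') ^ 2 := by positivity
  have hz := deriv_comp_and_deriv_deriv_comp (φ := fun t => xiDist ρ t ρ' z') isOpen_Ioo hg'
    (fun t => (hasDerivAt_xiDist_fst hA z' t).1) (hasDerivAt_xiDist_fst hA z' z).2 hξ
  have hρ := deriv_comp_and_deriv_deriv_comp (φ := fun t => xiDist t z ρ' z') isOpen_Ioo hg'
    (fun t => by simpa only [xiDist, add_assoc] using (hasDerivAt_xiDist_snd hK ρ' t).1)
    (hasDerivAt_xiDist_snd hK ρ' ρ).2 hξ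
  have hG : ∀ z ρ, Gbb h ρ' z' z ρ = radialPropagator h (xiDist ρ z ρ' z') := fun _ _ => rfl
  simp only [hG]
  rw [hz.2, hρ.1, hρ.2]
  have ode := (hg _ hξ).2.2
  have hN : Real.exp (-ρ - ρ') ^ 2 = Real.exp (-2 * ρ) * Real.exp (-2 * ρ') := by
    rw [← Real.exp_nat_mul, ← Real.exp_add]; push_cast; ring_nf
  set x := xiDist ρ z ρ' z'
  set N := Real.exp (-ρ - ρ')
  set E := Real.exp (-2 * ρ)
  set P := Real.exp (-2 * ρ')
  rw [← add_assoc E P]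
  have hD : E + P + (z - z') ^ 2 ≠ 0 := by positivity
  have hxe : x = 2 * N / (E + P + (z - z') ^ 2) := rfl
  have grad : E * (-2 * (2 * N) * (z - z') / (E + P + (z - z') ^ 2) ^ 2) ^ 2 +
      (2 * N * (E - (P + (z - z') ^ 2)) / (E + P + (z - z') ^ 2) ^ 2) ^ 2 =
      x ^ 2 * (1 - x ^ 2) := by
    rw [hxe]
    field_simp
    linear_combination (4 * N ^ 2) * hN
  have lap : E * (-2 * (2 * N) / (E + P + (z - z') ^ 2) ^ 2 +
        8 * (2 * N) * (z - z') ^ 2 / (E + P + (z - z') ^ 2) ^ 3) +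
      (2 * N * (P + (z - z') ^ 2 - 3 * E) / (E + P + (z - z') ^ 2) ^ 2 +
        8 * N * E * (E - (P + (z - z') ^ 2)) / (E + P + (z - z') ^ 2) ^ 3) +
      2 * N * (E - (P + (z - z') ^ 2)) / (E + P + (z - z') ^ 2) ^ 2 = -2 * x ^ 3 := by
    rw [hxe]
    field_simp
    linear_combination (16 * N) * hN
  linear_combination ode + g'' x * grad + g' x * lap
end

section
/- The Fourier-space solution of the Klein–Gordon Cauchy problem is unique: suppose h > 1/2, h + 1/2 ∉ ℤ, k ≠ 0, and F : (0,∞) → ℂ is a solution of (∂²_u + k² − h(h−1)/u²)F = 0 such that u^{−h} F(u) has a finite limit g as u → 0⁺. Then F(u) = 2^{h−1/2} Γ(h+1/2) |k|^{1/2−h} g · u^{1/2} J_{h−1/2}(|k|u). -/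
open scoped Topology

/-- The Bessel function of the first kind, defined by its series. -/
noncomputable def besselJ (α x : ℝ) : ℝ :=
  ∑' m : ℕ, (-1 : ℝ) ^ m / ((m.factorial : ℝ) * Real.Gamma ((m : ℝ) + α + 1)) *
    (x / 2) ^ (2 * (m : ℝ) + α)

/-- A solution of `w'' + (a/u) w' + k² w = 0` on `(0,∞)`, with `1 ≤ a`, vanishes
if it tends to `0` at `0⁺`. -/
theorem eq_zero_of_radial_ode {a k : ℝ} (ha : 1 ≤ a) (hk : k ≠ 0) {w w' w'' : ℝ → ℝ}
    (hd1 : ∀ u, 0 < u → HasDerivAt w (w' u) u)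
    (hd2 : ∀ u, 0 < u → HasDerivAt w' (w'' u) u)
    (hode : ∀ u, 0 < u → w'' u = -(a / u * w' u) - k ^ 2 * w u)
    (hlim : Filter.Tendsto w (𝓝[>] (0 : ℝ)) (𝓝 0)) {u : ℝ} (hu : 0 < u) : w u = 0 := by
  have hsmall : ∀ ε > 0, ∃ δ > 0, ∀ x, 0 < x → x < δ → |w x| < ε := by
    intro ε hε
    obtain ⟨δ, hδ, H⟩ := Metric.tendsto_nhdsWithin_nhds.1 hlim ε hε
    refine ⟨δ, hδ, fun x hx hxδ => ?_⟩
    simpa using H (Set.mem_Ioi.2 hx) (by simpa [abs_of_pos hx] using hxδ)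
  have hp : ∀ x, 0 < x →
      HasDerivAt (fun x => x ^ a * w' x) (-(k ^ 2 * x ^ a * w x)) x := by
    intro x hx
    have := (Real.hasDerivAt_rpow_const (p := a) (Or.inl hx.ne')).mul (hd2 x hx)
    refine this.congr_deriv ?_
    rw [hode x hx, Real.rpow_sub_one hx.ne']
    field_simp
    ring
  -- The flux `x ^ a * w' x` is small along a sequence tending to `0`.
  have hseq : ∀ ε > 0, ∀ b > 0, ∃ ξ, 0 < ξ ∧ ξ < b ∧ |ξ ^ a * w' ξ| ≤ ε := by
    intro ε hε b hb
    obtain ⟨δ, hδ, H⟩ := hsmall (ε / 4) (by positivity)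
    obtain ⟨x, hx0, hx⟩ := exists_between (lt_min (lt_min hδ hb) one_pos)
    simp only [lt_min_iff] at hx
    obtain ⟨ξ, ⟨h1, h2⟩, h3⟩ := exists_hasDerivAt_eq_slope w w' (half_lt_self hx0)
      (fun y hy => (hd1 y (by linarith [hy.1])).continuousAt.continuousWithinAt)
      (fun y hy => hd1 y (by linarith [hy.1]))
    have hξ : 0 < ξ := by linarith
    refine ⟨ξ, hξ, by linarith, ?_⟩
    have hA : |w' ξ| * (x / 2) ≤ ε / 2 := by
      have : w' ξ * (x / 2) = w x - w (x / 2) := by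
        rw [h3]; field_simp; ring
      rw [← abs_of_pos (half_pos hx0), ← abs_mul, this]
      have e1 := H x hx0 hx.1.1
      have e2 := H (x / 2) (by linarith) (by linarith)
      have := abs_sub (w x) (w (x / 2))
      linarith
    have hB : ξ ^ a ≤ x := by
      calc ξ ^ a ≤ ξ ^ (1 : ℝ) :=
            Real.rpow_le_rpow_of_exponent_ge hξ (by linarith) ha
        _ ≤ x := by rw [Real.rpow_one]; exact h2.le
    rw [abs_mul, abs_of_pos (Real.rpow_pos_of_pos hξ a)]
    calc ξ ^ a * |w' ξ| ≤ x * |w' ξ| := by gcongr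
      _ ≤ ε := by linarith
  obtain ⟨δ, hδ, hδw⟩ := hsmall 1 one_pos
  have hw' : ∀ x, 0 < x → x < δ → |w' x| ≤ k ^ 2 * x := by
    intro x hx hxδ
    have hxa := Real.rpow_pos_of_pos hx a
    have key : |x ^ a * w' x| ≤ k ^ 2 * x ^ a * x := by
      refine le_of_forall_pos_le_add fun ε hε => ?_
      obtain ⟨ξ, hξ, hξx, hξε⟩ := hseq ε hε x hx
      have := (convex_Icc ξ x).norm_image_sub_le_of_norm_hasDerivWithin_le
        (C := k ^ 2 * x ^ a) (f := fun x => x ^ a * w' x)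
        (fun y hy => (hp y (hξ.trans_le hy.1)).hasDerivWithinAt) (fun y hy => by
          have hy0 := hξ.trans_le hy.1
          rw [norm_neg, Real.norm_eq_abs, abs_mul, abs_of_nonneg (by positivity)]
          have h1 := (hδw y hy0 (hy.2.trans_lt hxδ)).le
          have h2 : y ^ a ≤ x ^ a := Real.rpow_le_rpow hy0.le hy.2 (by linarith)
          calc k ^ 2 * y ^ a * |w y| ≤ k ^ 2 * x ^ a * 1 := by gcongr
            _ = _ := mul_one _)
        (Set.left_mem_Icc.2 hξx.le) (Set.right_mem_Icc.2 hξx.le)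
      simp only [Real.norm_eq_abs] at this
      rw [abs_of_pos (sub_pos.2 hξx)] at this
      have h3 : k ^ 2 * x ^ a * (x - ξ) ≤ k ^ 2 * x ^ a * x := by
        gcongr; linarith
      have h4 := abs_sub_abs_le_abs_sub (x ^ a * w' x) (ξ ^ a * w' ξ)
      linarith
    rw [abs_mul, abs_of_pos hxa] at key
    exact le_of_mul_le_mul_left (by linarith) hxa
  have hw'lim : Filter.Tendsto w' (𝓝[>] (0 : ℝ)) (𝓝 0) := by
    have hb : Filter.Tendsto (fun x : ℝ => k ^ 2 * x) (𝓝[>] (0 : ℝ)) (𝓝 0) := by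
      have : Continuous fun x : ℝ => k ^ 2 * x := by fun_prop
      simpa using (this.tendsto 0).mono_left nhdsWithin_le_nhds
    refine squeeze_zero_norm' ?_ hb
    filter_upwards [Ioo_mem_nhdsGT hδ] with x hx using hw' x hx.1 hx.2
  -- The energy is nonincreasing and tends to `0` at `0⁺`.
  have hE : ∀ x, 0 < x → HasDerivAt (fun x => w' x ^ 2 + k ^ 2 * w x ^ 2)
      (-(2 * a / x * w' x ^ 2)) x := by
    intro x hx
    have := ((hd2 x hx).pow 2).add (((hd1 x hx).pow 2).const_mul (k ^ 2))
    refine this.congr_deriv ?_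
    rw [hode x hx]
    push_cast
    ring
  have hanti : AntitoneOn (fun x => w' x ^ 2 + k ^ 2 * w x ^ 2) (Set.Ioi 0) := by
    refine antitoneOn_of_deriv_nonpos (convex_Ioi 0)
      (fun x hx => (hE x hx).continuousAt.continuousWithinAt)
      (fun x hx => ?_) (fun x hx => ?_)
    · rw [interior_Ioi] at hx
      exact (hE x hx).differentiableAt.differentiableWithinAt
    · rw [interior_Ioi] at hx
      have hx' : 0 < x := hx
      rw [(hE x hx).deriv, neg_nonpos]
      positivity
  have hElim : Filter.Tendsto (fun x => w' x ^ 2 + k ^ 2 * w x ^ 2) (𝓝[>] (0 : ℝ)) (𝓝 0) := by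
    simpa using (hw'lim.pow 2).add ((hlim.pow 2).const_mul (k ^ 2))
  have hle : w' u ^ 2 + k ^ 2 * w u ^ 2 ≤ 0 := by
    refine ge_of_tendsto hElim ?_
    filter_upwards [Ioo_mem_nhdsGT hu] with x hx using hanti hx.1 hu hx.2.le
  have hk2 : 0 < k ^ 2 := by positivity
  have : k ^ 2 * w u ^ 2 = 0 := le_antisymm (by nlinarith [sq_nonneg (w' u)]) (by positivity)
  simpa [hk] using this

/-- Coefficients of exponential type: they define an entire power series. -/
def ExpBounded (c : ℕ → ℝ) : Prop :=
  ∃ C A : ℝ, 0 ≤ C ∧ 0 ≤ A ∧ ∀ m, |c m| ≤ C * (A ^ m / m.factorial)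

theorem ExpBounded.derivCoeff {c : ℕ → ℝ} (hc : ExpBounded c) :
    ExpBounded fun m => ((m : ℝ) + 1) * c (m + 1) := by
  obtain ⟨C, A, hC, hA, H⟩ := hc
  refine ⟨C * A, A, by positivity, hA, fun m => ?_⟩
  have h1 : (0 : ℝ) < (m : ℝ) + 1 := by positivity
  rw [abs_mul, abs_of_pos h1]
  calc ((m : ℝ) + 1) * |c (m + 1)|
      ≤ ((m : ℝ) + 1) * (C * (A ^ (m + 1) / (m + 1).factorial)) := by gcongr; exact H _
    _ = C * A * (A ^ m / m.factorial) := by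
      rw [Nat.factorial_succ]; push_cast; rw [pow_succ _ m]; field_simp

theorem ExpBounded.summable {c : ℕ → ℝ} (hc : ExpBounded c) (t : ℝ) :
    Summable fun m => c m * t ^ m := by
  obtain ⟨C, A, hC, hA, H⟩ := hc
  refine Summable.of_norm_bounded
    (g := fun m => C * ((A * |t|) ^ m / m.factorial))
    ((Real.summable_pow_div_factorial _).mul_left C) fun m => ?_
  rw [norm_mul, norm_pow, Real.norm_eq_abs, Real.norm_eq_abs, mul_pow]
  calc |c m| * |t| ^ m ≤ C * (A ^ m / m.factorial) * |t| ^ m := by gcongr; exact H m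
    _ = _ := by ring

theorem ExpBounded.hasDerivAt_tsum {c : ℕ → ℝ} (hc : ExpBounded c) (t : ℝ) :
    HasDerivAt (fun t => ∑' m, c m * t ^ m)
      (∑' m : ℕ, ((m : ℝ) + 1) * c (m + 1) * t ^ m) t := by
  obtain ⟨C, A, hC, hA, H⟩ := hc.derivCoeff
  set R := |t| + 1
  have hR : 0 ≤ R := by positivity
  have hbound : Summable fun m : ℕ => C * ((A * R) ^ m / m.factorial) :=
    (Real.summable_pow_div_factorial _).mul_left C
  have hmem : t ∈ Metric.ball (0 : ℝ) R := by simp [R]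
  have key := hasDerivAt_tsum_of_isPreconnected
    (u := fun m : ℕ => C * ((A * R) ^ m / m.factorial))
    (g := fun m t => c (m + 1) * t ^ (m + 1))
    (g' := fun m t => ((m : ℝ) + 1) * c (m + 1) * t ^ m)
    hbound Metric.isOpen_ball (convex_ball (0 : ℝ) R).isPreconnected
    (fun m y _ => by
      have := (hasDerivAt_pow (m + 1) y).const_mul (c (m + 1))
      refine this.congr_deriv ?_
      push_cast
      ring)
    (fun m y hy => by
      have hy' : |y| ≤ R := by simpa using (mem_ball_zero_iff.1 hy).le
      rw [norm_mul, norm_pow, Real.norm_eq_abs, Real.norm_eq_abs, mul_pow]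
      calc |((m : ℝ) + 1) * c (m + 1)| * |y| ^ m
          ≤ C * (A ^ m / m.factorial) * R ^ m := by gcongr; exact H m
        _ = _ := by ring)
    hmem ((summable_nat_add_iff 1).2 (hc.summable t)) hmem
  have heq : (fun t => ∑' m, c m * t ^ m) =
      fun t => c 0 + ∑' m, c (m + 1) * t ^ (m + 1) := by
    funext y
    rw [(hc.summable y).tsum_eq_zero_add]
    simp
  rw [heq]
  exact key.const_add _

/-- Coefficients of the entire series `φ` such that `u ↦ u ^ h * φ (u ^ 2)` is the regular
solution of the Klein–Gordon equation normalized by `φ 0 = 1`. -/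
noncomputable def regularCoeff (h k : ℝ) (m : ℕ) : ℝ :=
  Real.Gamma (h + 1/2) * (-(k ^ 2 / 4)) ^ m / (m.factorial * Real.Gamma ((m : ℝ) + h + 1/2))

theorem regularCoeff_zero {h : ℝ} (hh : 1/2 < h) (k : ℝ) : regularCoeff h k 0 = 1 := by
  have : Real.Gamma (h + 1/2) ≠ 0 := (Real.Gamma_pos_of_pos (by linarith)).ne'
  simp only [regularCoeff, pow_zero, Nat.factorial_zero, Nat.cast_zero, zero_add, Nat.cast_one,
    one_mul, mul_one]
  exact div_self this

theorem regularCoeff_succ {h : ℝ} (hh : 1/2 < h) (k : ℝ) (m : ℕ) :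
    ((m : ℝ) + 1) * ((m : ℝ) + h + 1/2) * regularCoeff h k (m + 1) =
      -(k ^ 2 / 4) * regularCoeff h k m := by
  have hm : (0 : ℝ) ≤ m := m.cast_nonneg
  have hpos : 0 < (m : ℝ) + h + 1/2 := by linarith
  have hG : Real.Gamma ((m : ℝ) + h + 1/2) ≠ 0 := (Real.Gamma_pos_of_pos hpos).ne'
  have hf : (m.factorial : ℝ) ≠ 0 := by positivity
  have hm1 : (m : ℝ) + 1 ≠ 0 := by positivity
  have hs : ((m + 1 : ℕ) : ℝ) + h + 1/2 = ((m : ℝ) + h + 1/2) + 1 := by push_cast; ring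
  unfold regularCoeff
  rw [hs, Real.Gamma_add_one hpos.ne', Nat.factorial_succ, pow_succ]
  push_cast
  generalize hx : (m : ℝ) + h + 1/2 = x at *
  have hx0 : x ≠ 0 := hpos.ne'
  field_simp

theorem expBounded_regularCoeff {h : ℝ} (hh : 1/2 < h) (k : ℝ) :
    ExpBounded (regularCoeff h k) := by
  refine ⟨1, k ^ 2 / 4, zero_le_one, by positivity, fun m => ?_⟩
  rw [one_mul]
  induction m with
  | zero => simp [regularCoeff_zero hh]
  | succ m ih =>
    have hm : (0 : ℝ) ≤ m := m.cast_nonneg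
    have hm1 : (0 : ℝ) < (m : ℝ) + 1 := by positivity
    have hrec := congrArg abs (regularCoeff_succ hh k m)
    rw [abs_mul, abs_mul, abs_mul, abs_neg, abs_of_pos hm1,
      abs_of_pos (show 0 < (m : ℝ) + h + 1/2 by linarith),
      abs_of_nonneg (show 0 ≤ k ^ 2 / 4 by positivity)] at hrec
    have h1 : ((m : ℝ) + 1) * |regularCoeff h k (m + 1)| ≤
        ((m : ℝ) + 1) * ((m : ℝ) + h + 1/2) * |regularCoeff h k (m + 1)| := by
      have : 0 ≤ ((m : ℝ) + 1) * |regularCoeff h k (m + 1)| := by positivity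
      nlinarith
    refine le_of_mul_le_mul_left ?_ hm1
    calc ((m : ℝ) + 1) * |regularCoeff h k (m + 1)|
        ≤ k ^ 2 / 4 * ((k ^ 2 / 4) ^ m / m.factorial) := by
          rw [hrec] at h1; exact h1.trans (by gcongr)
      _ = ((m : ℝ) + 1) * ((k ^ 2 / 4) ^ (m + 1) / (m + 1).factorial) := by
          rw [Nat.factorial_succ]; push_cast; rw [pow_succ _ m]; field_simp

/-- The series with coefficients `regularCoeff` solves `t φ'' + (h + 1/2) φ' + (k²/4) φ = 0`. -/
theorem regularCoeff_tsum_ode {h : ℝ} (hh : 1/2 < h) (k t : ℝ) :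
    t * (∑' m : ℕ, ((m : ℝ) + 1) * (((m + 1 : ℕ) : ℝ) + 1) * regularCoeff h k (m + 1 + 1) * t ^ m)
      + (h + 1/2) * (∑' m : ℕ, ((m : ℝ) + 1) * regularCoeff h k (m + 1) * t ^ m)
      + k ^ 2 / 4 * (∑' m, regularCoeff h k m * t ^ m) = 0 := by
  have hc := expBounded_regularCoeff hh k
  have s0 := hc.summable t
  have s1 := hc.derivCoeff.summable t
  have s2 := hc.derivCoeff.derivCoeff.summable t
  have s2' : Summable fun m : ℕ => (m : ℝ) * ((m : ℝ) + 1) * regularCoeff h k (m + 1) * t ^ m := by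
    refine (summable_nat_add_iff 1).1 ((s2.mul_left t).congr fun m => ?_)
    push_cast
    ring
  have e2 : t * (∑' m : ℕ, ((m : ℝ) + 1) * (((m + 1 : ℕ) : ℝ) + 1) * regularCoeff h k (m + 1 + 1)
      * t ^ m) = ∑' m : ℕ, (m : ℝ) * ((m : ℝ) + 1) * regularCoeff h k (m + 1) * t ^ m := by
    rw [s2'.tsum_eq_zero_add, ← tsum_mul_left]
    simp only [Nat.cast_zero, zero_mul, zero_add]
    refine tsum_congr fun m => ?_
    push_cast
    ring
  rw [e2, ← tsum_mul_left, ← tsum_mul_left, ← s2'.tsum_add (s1.mul_left _),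
    ← (s2'.add (s1.mul_left _)).tsum_add (s0.mul_left _)]
  refine (tsum_congr fun m => ?_).trans tsum_zero
  linear_combination t ^ m * regularCoeff_succ hh k m

theorem besselJ_eq_regular {h k u : ℝ} (hk : k ≠ 0) (hu : 0 < u) :
    (2 : ℝ) ^ (h - 1/2) * Real.Gamma (h + 1/2) * |k| ^ (1/2 - h) *
        (u ^ ((1:ℝ)/2) * besselJ (h - 1/2) (|k| * u)) =
      u ^ h * ∑' m, regularCoeff h k m * (u ^ 2) ^ m := by
  have hk' : 0 < |k| := abs_pos.2 hk
  rw [besselJ, ← mul_assoc, ← tsum_mul_left, ← tsum_mul_left]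
  refine tsum_congr fun m => ?_
  have hx : 0 < |k| * u / 2 := by positivity
  have e1 : (|k| * u / 2) ^ (2 * (m : ℝ) + (h - 1/2)) =
      (k ^ 2 / 4) ^ m * (u ^ 2) ^ m * (|k| ^ (h - 1/2) * u ^ (h - 1/2) / 2 ^ (h - 1/2)) := by
    rw [Real.rpow_add hx, Real.div_rpow (z := h - 1/2) (by positivity) zero_le_two,
      Real.mul_rpow (z := h - 1/2) hk'.le hu.le]
    congr 1
    rw [show (2 * (m : ℝ)) = ((2 * m : ℕ) : ℝ) by push_cast; ring, Real.rpow_natCast,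
      pow_mul, ← mul_pow, div_pow, mul_pow, sq_abs]
    congr 1
    ring
  have e2 : |k| ^ (1/2 - h) = (|k| ^ (h - 1/2))⁻¹ := by
    rw [← Real.rpow_neg hk'.le]; congr 1; ring
  have e3 : u ^ h = u ^ ((1:ℝ)/2) * u ^ (h - 1/2) := by
    rw [← Real.rpow_add hu]; congr 1; ring
  have e4 : (m : ℝ) + (h - 1/2) + 1 = (m : ℝ) + h + 1/2 := by ring
  rw [e1, e2, e3, e4, regularCoeff, neg_pow (k ^ 2 / 4) m]
  have h1 : |k| ^ (h - 1/2) ≠ 0 := (Real.rpow_pos_of_pos hk' _).ne'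
  have h2 : (2 : ℝ) ^ (h - 1/2) ≠ 0 := (Real.rpow_pos_of_pos two_pos _).ne'
  field_simp

/-- Real-valued solutions with `u ^ (-h) * f u → g` at `0⁺` are multiples of the regular one. -/
theorem klein_gordon_real_uniqueness {h k : ℝ} (hh : 1/2 < h) (hk : k ≠ 0)
    {f f' f'' : ℝ → ℝ} {g : ℝ}
    (hd1 : ∀ u, 0 < u → HasDerivAt f (f' u) u)
    (hd2 : ∀ u, 0 < u → HasDerivAt f' (f'' u) u)
    (hode : ∀ u, 0 < u → f'' u + (k ^ 2 - h * (h - 1) / u ^ 2) * f u = 0)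
    (hlim : Filter.Tendsto (fun u => u ^ (-h) * f u) (𝓝[>] (0 : ℝ)) (𝓝 g))
    {u : ℝ} (hu : 0 < u) :
    f u = u ^ h * (∑' m, regularCoeff h k m * (u ^ 2) ^ m) * g := by
  have hc := expBounded_regularCoeff hh k
  have hφode := regularCoeff_tsum_ode hh k
  have hφ0 : (∑' m, regularCoeff h k m * (0 : ℝ) ^ m) = 1 := by
    rw [tsum_eq_single 0 fun m hm => by simp [hm]]
    simp [regularCoeff_zero hh]
  have hφ1 := hc.hasDerivAt_tsum
  have hφ2 : ∀ t, HasDerivAt (fun t => ∑' m : ℕ, ((m : ℝ) + 1) * regularCoeff h k (m + 1) * t ^ m)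
      (∑' m : ℕ, ((m : ℝ) + 1) * (((m + 1 : ℕ) : ℝ) + 1) * regularCoeff h k (m + 1 + 1) * t ^ m)
      t := fun t => by
    simpa only [mul_assoc] using hc.derivCoeff.hasDerivAt_tsum t
  set φ : ℝ → ℝ := fun t => ∑' m, regularCoeff h k m * t ^ m
  set φ' : ℝ → ℝ := fun t => ∑' m : ℕ, ((m : ℝ) + 1) * regularCoeff h k (m + 1) * t ^ m
  set φ'' : ℝ → ℝ := fun t =>
    ∑' m : ℕ, ((m : ℝ) + 1) * (((m + 1 : ℕ) : ℝ) + 1) * regularCoeff h k (m + 1 + 1) * t ^ m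
  change ∀ t, HasDerivAt φ (φ' t) t at hφ1
  change ∀ t, HasDerivAt φ' (φ'' t) t at hφ2
  change ∀ t, t * φ'' t + (h + 1/2) * φ' t + k ^ 2 / 4 * φ t = 0 at hφode
  change φ 0 = 1 at hφ0
  change f u = u ^ h * φ (u ^ 2) * g
  have hsq : ∀ x : ℝ, HasDerivAt (fun x : ℝ => x ^ 2) (2 * x) x := fun x => by
    simpa using hasDerivAt_pow 2 x
  have hW1 : ∀ x, HasDerivAt (fun x => φ (x ^ 2)) (φ' (x ^ 2) * (2 * x)) x := fun x =>
    HasDerivAt.comp (h₂ := φ) x (hφ1 (x ^ 2)) (hsq x)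
  have hW2 : ∀ x, HasDerivAt (fun x => φ' (x ^ 2) * (2 * x))
      (φ'' (x ^ 2) * (2 * x) * (2 * x) + φ' (x ^ 2) * 2) x := fun x => by
    have := (HasDerivAt.comp (h₂ := φ') x (hφ2 (x ^ 2)) (hsq x)).mul
      ((hasDerivAt_id x).const_mul 2)
    refine this.congr_deriv ?_
    simp
  have hv : ∀ x, 0 < x → ∀ {q q' p : ℝ} {r : ℝ → ℝ}, HasDerivAt r q' x → r x = q →
      HasDerivAt (fun x => x ^ p * r x) (x ^ p * (q' + p / x * q)) x := by
    intro x hx q q' p r hr hq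
    have := (Real.hasDerivAt_rpow_const (p := p) (Or.inl hx.ne')).mul hr
    refine this.congr_deriv ?_
    rw [Real.rpow_sub_one hx.ne', hq]
    ring
  have hzero := eq_zero_of_radial_ode (a := 2 * h) (k := k) (by linarith) hk
    (w := fun x => x ^ (-h) * f x - g * φ (x ^ 2))
    (w' := fun x => x ^ (-h) * (f' x + -h / x * f x) - g * (φ' (x ^ 2) * (2 * x)))
    (w'' := fun x => x ^ (-h) * ((f'' x + (-h / x * f' x + h / x ^ 2 * f x)) +
        -h / x * (f' x + -h / x * f x))
      - g * (φ'' (x ^ 2) * (2 * x) * (2 * x) + φ' (x ^ 2) * 2))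
    (fun x hx => (hv x hx (hd1 x hx) rfl).sub ((hW1 x).const_mul g))
    (fun x hx => by
      refine (hv x hx ((hd2 x hx).add ?_) rfl).sub ((hW2 x).const_mul g)
      have h1 : HasDerivAt (fun x : ℝ => -h / x) (h / x ^ 2) x := by
        have := (hasDerivAt_inv hx.ne').const_mul (-h)
        refine this.congr_deriv ?_
        field_simp
      refine (h1.mul (hd1 x hx)).congr_deriv ?_
      ring)
    (fun x hx => by
      have h1 : f'' x = -((k ^ 2 - h * (h - 1) / x ^ 2) * f x) := by linarith [hode x hx]
      have h2 := hφode (x ^ 2)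
      simp only [h1]
      field_simp
      linear_combination (-4 * g * x ^ 2) * h2)
    (by
      have h1 : Filter.Tendsto (fun x => φ (x ^ 2)) (𝓝[>] (0 : ℝ)) (𝓝 1) := by
        have := (hW1 0).continuousAt.tendsto
        simp only [ne_eq, OfNat.ofNat_ne_zero, not_false_eq_true, zero_pow, hφ0] at this
        exact this.mono_left nhdsWithin_le_nhds
      simpa using hlim.sub (h1.const_mul g))
    hu
  have hum : u ^ h * u ^ (-h) = 1 := by rw [← Real.rpow_add hu]; simp
  linear_combination u ^ h * hzero - f u * hum

/-- Uniqueness of the Fourier-space solution of the Klein–Gordon Cauchy problem: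
a solution of `(∂²_u + k² − h(h−1)/u²)F = 0` on `(0,∞)` with
`u^{−h}F(u) → g` as `u → 0⁺` is the regular Bessel solution. -/
theorem cauchy_problem_uniqueness (h k : ℝ) (hh : 1/2 < h)
    (hhalf : ∀ n : ℤ, h + 1/2 ≠ (n : ℝ)) (hk : k ≠ 0)
    (F F' F'' : ℝ → ℂ) (g : ℂ)
    (hd1 : ∀ u ∈ Set.Ioi (0 : ℝ), HasDerivAt F (F' u) u)
    (hd2 : ∀ u ∈ Set.Ioi (0 : ℝ), HasDerivAt F' (F'' u) u)
    (hode : ∀ u ∈ Set.Ioi (0 : ℝ), F'' u + ((k ^ 2 : ℝ) - h * (h - 1) / u ^ 2) * F u = 0)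
    (hbdry : Filter.Tendsto (fun u : ℝ => ((u ^ (-h) : ℝ) : ℂ) * F u)
      (𝓝[>] (0 : ℝ)) (𝓝 g)) :
    ∀ u ∈ Set.Ioi (0 : ℝ),
      F u = (((2 : ℝ) ^ (h - 1/2) * Real.Gamma (h + 1/2) * |k| ^ (1/2 - h) *
        (u ^ ((1:ℝ)/2) * besselJ (h - 1/2) (|k| * u)) : ℝ) : ℂ) * g := by
  have hcoef : ∀ x : ℝ, ((k ^ 2 - h * (h - 1) / x ^ 2 : ℝ) : ℂ) =
      (k ^ 2 : ℝ) - h * (h - 1) / x ^ 2 := fun x => by push_cast; ring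
  intro u hu
  have hre := klein_gordon_real_uniqueness hh hk
    (f := fun x => (F x).re) (f' := fun x => (F' x).re) (f'' := fun x => (F'' x).re) (g := g.re)
    (fun x hx => Complex.reCLM.hasFDerivAt.comp_hasDerivAt x (hd1 x hx))
    (fun x hx => Complex.reCLM.hasFDerivAt.comp_hasDerivAt x (hd2 x hx))
    (fun x hx => by
      have := congrArg Complex.re (hode x hx)
      rw [← hcoef, Complex.add_re, Complex.re_ofReal_mul] at this
      exact this)
    (by simpa only [Function.comp_def, Complex.re_ofReal_mul] using
      (Complex.continuous_re.tendsto g).comp hbdry) hu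
  have him := klein_gordon_real_uniqueness hh hk
    (f := fun x => (F x).im) (f' := fun x => (F' x).im) (f'' := fun x => (F'' x).im) (g := g.im)
    (fun x hx => Complex.imCLM.hasFDerivAt.comp_hasDerivAt x (hd1 x hx))
    (fun x hx => Complex.imCLM.hasFDerivAt.comp_hasDerivAt x (hd2 x hx))
    (fun x hx => by
      have := congrArg Complex.im (hode x hx)
      rw [← hcoef, Complex.add_im, Complex.im_ofReal_mul] at this
      exact this)
    (by simpa only [Function.comp_def, Complex.im_ofReal_mul] using
      (Complex.continuous_im.tendsto g).comp hbdry) hu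
  rw [besselJ_eq_regular hk hu]
  apply Complex.ext
  · rw [Complex.re_ofReal_mul]; exact hre
  · rw [Complex.im_ofReal_mul]; exact him
end
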